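/- For any formula F and any propositional formula N, the formulas N ⊃ F and ¬N ∨ F are equivalent in LJ+: both sequents N ⊃ F ⊢ ¬N ∨ F and ¬N ∨ F ⊢ N ⊃ F are derivable in LJ+. -/

import Mathlib

/-! Syntax of first-order formulas. Atoms are either propositional symbols
(arity-0) or predicate symbols of arity ≥ 1 applied to variables.
There are no function symbols or object constants: terms are variables (ℕ). -/

inductive Formula : Type
  | prop : ℕ → Formula                      -- propositional symbol
  | pred : ℕ → ℕ → List ℕ → Formula         -- predicate symbol (arity ≥ 1) applied to variables
  | top : Formula
  | bot : Formula
  | and : Formula → Formula → Formula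
  | or : Formula → Formula → Formula
  | imp : Formula → Formula → Formula
  | neg : Formula → Formula
  | all : ℕ → Formula → Formula             -- ∀x A
  | ex : ℕ → Formula → Formula              -- ∃x A
  deriving DecidableEq

namespace Formula

/-- Free variables of a formula. -/
def fv : Formula → Finset ℕ
  | prop _ => ∅
  | pred _ x xs => insert x xs.toFinset
  | top => ∅
  | bot => ∅
  | and A B => fv A ∪ fv B
  | or A B => fv A ∪ fv B
  | imp A B => fv A ∪ fv B
  | neg A => fv A
  | all x A => (fv A).erase x
  | ex x A => (fv A).erase x

/-- All variables occurring in a formula (free or bound, including binders). -/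
def vars : Formula → Finset ℕ
  | prop _ => ∅
  | pred _ x xs => insert x xs.toFinset
  | top => ∅
  | bot => ∅
  | and A B => vars A ∪ vars B
  | or A B => vars A ∪ vars B
  | imp A B => vars A ∪ vars B
  | neg A => vars A
  | all x A => insert x (vars A)
  | ex x A => insert x (vars A)

/-- Binder variables of a formula. -/
def bv : Formula → Finset ℕ
  | prop _ => ∅
  | pred _ _ _ => ∅
  | top => ∅
  | bot => ∅
  | and A B => bv A ∪ bv B
  | or A B => bv A ∪ bv B
  | imp A B => bv A ∪ bv B
  | neg A => bv A
  | all x A => insert x (bv A)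
  | ex x A => insert x (bv A)

/-- `rename a b F` replaces the free occurrences of variable `a` in `F` by variable `b`.
`F.rename a b` plays the role of "F(b)" when `F` is "F(a)". -/
def rename (a b : ℕ) : Formula → Formula
  | prop n => prop n
  | pred n x xs =>
      pred n (if x = a then b else x) (xs.map fun y => if y = a then b else y)
  | top => top
  | bot => bot
  | and A B => and (rename a b A) (rename a b B)
  | or A B => or (rename a b A) (rename a b B)
  | imp A B => imp (rename a b A) (rename a b B)
  | neg A => neg (rename a b A)
  | all x A => if x = a then all x A else all x (rename a b A)
  | ex x A => if x = a then ex x A else ex x (rename a b A)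

/-- A formula is propositional if it is built from propositional symbols (and ⊤, ⊥)
by the propositional connectives only. -/
def Propositional : Formula → Prop
  | prop _ => True
  | pred _ _ _ => False
  | top => True
  | bot => True
  | and A B => Propositional A ∧ Propositional B
  | or A B => Propositional A ∧ Propositional B
  | imp A B => Propositional A ∧ Propositional B
  | neg A => Propositional A
  | all _ _ => False
  | ex _ _ => False

/-- A formula is purely predicate if all its atoms are built from predicate symbols
of arity > 0 (it contains no propositional symbols). -/
def PurelyPredicate : Formula → Prop
  | prop _ => False
  | pred _ _ _ => True
  | top => True
  | bot => True
  | and A B => PurelyPredicate A ∧ PurelyPredicate B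
  | or A B => PurelyPredicate A ∧ PurelyPredicate B
  | imp A B => PurelyPredicate A ∧ PurelyPredicate B
  | neg A => PurelyPredicate A
  | all _ A => PurelyPredicate A
  | ex _ A => PurelyPredicate A

/-- Truth-table evaluation of a propositional formula under assignment `v`. -/
def evalP (v : ℕ → Bool) : Formula → Bool
  | prop n => v n
  | pred _ _ _ => false
  | top => true
  | bot => false
  | and A B => evalP v A && evalP v B
  | or A B => evalP v A || evalP v B
  | imp A B => !evalP v A || evalP v B
  | neg A => !evalP v A
  | all _ _ => false
  | ex _ _ => false

/-- A (propositional) formula is classically valid / derivable in classical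
propositional logic if it is true under every truth-value assignment. -/
def ClassicallyValid (A : Formula) : Prop := ∀ v : ℕ → Bool, evalP v A = true

/-- `substProp R C A` replaces all occurrences of the propositional symbol `R`
in `A` by the formula `C` (written A{R|C} in the paper). -/
def substProp (R : ℕ) (C : Formula) : Formula → Formula
  | prop n => if n = R then C else prop n
  | pred n x xs => pred n x xs
  | top => top
  | bot => bot
  | and A B => and (substProp R C A) (substProp R C B)
  | or A B => or (substProp R C A) (substProp R C B)
  | imp A B => imp (substProp R C A) (substProp R C B)
  | neg A => neg (substProp R C A)
  | all x A => all x (substProp R C A)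
  | ex x A => ex x (substProp R C A)

/-- `polProps b F` is the set of propositional symbols having an occurrence of
polarity `b` in `F` (`true` = positive, `false` = negative); `F` itself is a
positive occurrence, ∨ & quantifiers preserve polarity, ¬ flips it, and
`A ⊃ B` flips the polarity of `A` and preserves that of `B`. -/
def polProps : Bool → Formula → Finset ℕ
  | b, prop n => if b then {n} else ∅
  | _, pred _ _ _ => ∅
  | _, top => ∅
  | _, bot => ∅
  | b, and A B => polProps b A ∪ polProps b B
  | b, or A B => polProps b A ∪ polProps b B
  | b, imp A B => polProps (!b) A ∪ polProps b B
  | b, neg A => polProps (!b) A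
  | b, all _ A => polProps b A
  | b, ex _ A => polProps b A

/-- The propositional symbols occurring in a formula. -/
def propSyms (F : Formula) : Finset ℕ := polProps true F ∪ polProps false F

/-- A formula is unipolar if the occurrences of every propositional symbol in it
are either all positive or all negative. -/
def Unipolar (F : Formula) : Prop :=
  ∀ n : ℕ, ¬ (n ∈ polProps true F ∧ n ∈ polProps false F)

end Formula

/-- A sequent Γ ⊢ Λ: the antecedent is a finite sequence of formulas and the
succedent contains at most one formula. -/
abbrev Sequent := List Formula × Option Formula

/-- Free variables of a list of formulas. -/
def fvList (Γ : List Formula) : Finset ℕ := Γ.foldr (fun A s => A.fv ∪ s) ∅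

/-- Free variables of an optional succedent formula. -/
def fvOpt : Option Formula → Finset ℕ
  | none => ∅
  | some A => A.fv

/-- Inference rules (conclusion, list of premises) of Gentzen-style sequent calculi.
The flag `cut` enables the cut rule, the flag `neut` enables the neutralization
rule (restricted to propositional formulas `N`), and `lem` determines the class of
formulas `A` for which the axiom `⊢ A ∨ ¬A` is available. -/
inductive Rule (cut neut : Bool) (lem : Formula → Prop) : Sequent → List Sequent → Prop
  | ax (A : Formula) : Rule cut neut lem ([A], some A) []
  | topR : Rule cut neut lem ([], some .top) []
  | botL : Rule cut neut lem ([.bot], none) []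
  | thinL (A : Formula) (Γ : List Formula) (Λ : Option Formula) :
      Rule cut neut lem (A :: Γ, Λ) [(Γ, Λ)]
  | thinR (A : Formula) (Γ : List Formula) :
      Rule cut neut lem (Γ, some A) [(Γ, none)]
  | contr (A : Formula) (Γ : List Formula) (Λ : Option Formula) :
      Rule cut neut lem (A :: Γ, Λ) [(A :: A :: Γ, Λ)]
  | exch (Δ Γ : List Formula) (A B : Formula) (Λ : Option Formula) :
      Rule cut neut lem (Δ ++ B :: A :: Γ, Λ) [(Δ ++ A :: B :: Γ, Λ)]
  | cut' (Γ Δ : List Formula) (C : Formula) (Λ : Option Formula) (hc : cut = true) :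
      Rule cut neut lem (Γ ++ Δ, Λ) [(Γ, some C), (C :: Δ, Λ)]
  | andR (Γ : List Formula) (A B : Formula) :
      Rule cut neut lem (Γ, some (A.and B)) [(Γ, some A), (Γ, some B)]
  | andL1 (A B : Formula) (Γ : List Formula) (Λ : Option Formula) :
      Rule cut neut lem (A.and B :: Γ, Λ) [(A :: Γ, Λ)]
  | andL2 (A B : Formula) (Γ : List Formula) (Λ : Option Formula) :
      Rule cut neut lem (A.and B :: Γ, Λ) [(B :: Γ, Λ)]
  | orL (A B : Formula) (Γ : List Formula) (Λ : Option Formula) :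
      Rule cut neut lem (A.or B :: Γ, Λ) [(A :: Γ, Λ), (B :: Γ, Λ)]
  | orR1 (Γ : List Formula) (A B : Formula) :
      Rule cut neut lem (Γ, some (A.or B)) [(Γ, some A)]
  | orR2 (Γ : List Formula) (A B : Formula) :
      Rule cut neut lem (Γ, some (A.or B)) [(Γ, some B)]
  | negR (A : Formula) (Γ : List Formula) :
      Rule cut neut lem (Γ, some A.neg) [(A :: Γ, none)]
  | negL (A : Formula) (Γ : List Formula) :
      Rule cut neut lem (A.neg :: Γ, none) [(Γ, some A)]
  | impR (A B : Formula) (Γ : List Formula) :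
      Rule cut neut lem (Γ, some (A.imp B)) [(A :: Γ, some B)]
  | impL (A B : Formula) (Γ Δ : List Formula) (Λ : Option Formula) :
      Rule cut neut lem (A.imp B :: (Γ ++ Δ), Λ) [(Γ, some A), (B :: Δ, Λ)]
  | allR (Γ : List Formula) (x a : ℕ) (G : Formula)
      (ha : a ∉ fvList Γ ∪ (Formula.all x G).fv) (hv : a ∉ G.vars) :
      Rule cut neut lem (Γ, some (.all x G)) [(Γ, some (G.rename x a))]
  | allL (x : ℕ) (G : Formula) (a : ℕ) (Γ : List Formula) (Λ : Option Formula)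
      (hc : a = x ∨ a ∉ G.bv) :
      Rule cut neut lem (.all x G :: Γ, Λ) [(G.rename x a :: Γ, Λ)]
  | exR (Γ : List Formula) (x : ℕ) (G : Formula) (a : ℕ)
      (hc : a = x ∨ a ∉ G.bv) :
      Rule cut neut lem (Γ, some (.ex x G)) [(Γ, some (G.rename x a))]
  | exL (x : ℕ) (G : Formula) (a : ℕ) (Γ : List Formula) (Λ : Option Formula)
      (ha : a ∉ (fvList Γ ∪ (Formula.ex x G).fv) ∪ fvOpt Λ) (hv : a ∉ G.vars) :
      Rule cut neut lem (.ex x G :: Γ, Λ) [(G.rename x a :: Γ, Λ)]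
  | neut' (N : Formula) (Γ : List Formula) (Λ : Option Formula)
      (hn : neut = true) (hN : N.Propositional) :
      Rule cut neut lem (Γ, Λ) [(N :: Γ, Λ), (N.neg :: Γ, Λ)]
  | lemAx (A : Formula) (h : lem A) :
      Rule cut neut lem ([], some (A.or A.neg)) []

/-- Derivability from a set of rules. -/
inductive Derives (R : Sequent → List Sequent → Prop) : Sequent → Prop
  | step {s : Sequent} {ps : List Sequent} :
      R s ps → (∀ p ∈ ps, Derives R p) → Derives R s

/-- No additional excluded-middle axioms. -/
def NoLem : Formula → Prop := fun _ => False

/-- LJ: Gentzen's intuitionistic sequent calculus. -/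
def LJ : Sequent → Prop := Derives (Rule true false NoLem)

/-- LJ+: LJ extended with the neutralization rule. -/
def LJPlus : Sequent → Prop := Derives (Rule true true NoLem)

/-- Cut-free LJ+. -/
def LJPlusCF : Sequent → Prop := Derives (Rule false true NoLem)

/-- LJ extended with the axiom schema ⊢ A ∨ ¬A for every propositional symbol A. -/
def LJLemPropAtoms : Sequent → Prop :=
  Derives (Rule true false (fun A => ∃ n : ℕ, A = Formula.prop n))

/-- LK: Gentzen's classical sequent calculus, presented equivalently as
LJ plus the axiom schema ⊢ A ∨ ¬A for arbitrary formulas A. -/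
def LK : Sequent → Prop := Derives (Rule true false (fun _ => True))

/-- A formula is a theorem of LJ+ if the sequent ⊢ F is derivable. -/
def LJPlusThm (F : Formula) : Prop := LJPlus ([], some F)

def LJThm (F : Formula) : Prop := LJ ([], some F)

def LKThm (F : Formula) : Prop := LK ([], some F)

/-- Intuitionistic Kripke structures: a partially ordered set of nodes with
monotone nonempty domains and monotone valuations for propositional symbols
and for predicate symbols. -/
structure Kripke where
  W : Type
  U : Type
  le : W → W → Prop
  le_refl : ∀ w, le w w
  le_trans : ∀ u v w, le u v → le v w → le u w
  le_antisymm : ∀ u v, le u v → le v u → u = v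
  D : W → Set U
  D_ne : ∀ w, (D w).Nonempty
  D_mono : ∀ {w w'}, le w w' → D w ⊆ D w'
  TP : W → ℕ → Prop
  TQ : W → ℕ → List U → Prop
  TP_mono : ∀ {w w'}, le w w' → ∀ n, TP w n → TP w' n
  TQ_mono : ∀ {w w'}, le w w' → ∀ n ds, TQ w n ds → TQ w' n ds

/-- A constrained Kripke structure: for all nodes k ≤ k' and every propositional
symbol Q, Q is in the valuation of k if and only if it is in the valuation of k'. -/
def Kripke.Constrained (K : Kripke) : Prop :=
  ∀ {w w' : K.W}, K.le w w' → ∀ n : ℕ, (K.TP w n ↔ K.TP w' n)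

/-- The standard intuitionistic forcing relation (with an assignment σ of
domain elements to variables). -/
def Kripke.forces (K : Kripke) : K.W → (ℕ → K.U) → Formula → Prop
  | w, _, .prop n => K.TP w n
  | w, σ, .pred n x xs => K.TQ w n ((x :: xs).map σ)
  | _, _, .top => True
  | _, _, .bot => False
  | w, σ, .and A B => K.forces w σ A ∧ K.forces w σ B
  | w, σ, .or A B => K.forces w σ A ∨ K.forces w σ B
  | w, σ, .imp A B => ∀ w', K.le w w' → K.forces w' σ A → K.forces w' σ B
  | w, σ, .neg A => ∀ w', K.le w w' → ¬ K.forces w' σ A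
  | w, σ, .all x A => ∀ w', K.le w w' → ∀ d ∈ K.D w', K.forces w' (Function.update σ x d) A
  | w, σ, .ex x A => ∃ d ∈ K.D w, K.forces w (Function.update σ x d) A

/-- Validity of a sequent with respect to constrained Kripke structures:
at every node of every constrained Kripke structure (under every assignment into
the node's domain), either some antecedent formula is not forced, or the
succedent is nonempty and its formula is forced. -/
def SeqValid (s : Sequent) : Prop :=
  ∀ K : Kripke, K.Constrained → ∀ w : K.W, ∀ σ : ℕ → K.U, (∀ n, σ n ∈ K.D w) →
    (∃ A ∈ s.1, ¬ K.forces w σ A) ∨ (∃ A, s.2 = some A ∧ K.forces w σ A)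
namespace Derives

variable {R : Sequent → List Sequent → Prop} {s p q : Sequent}

theorem of_nullary (h : R s []) : Derives R s :=
  step h (by simp)

theorem of_unary (h : R s [p]) (hp : Derives R p) : Derives R s :=
  step h (by simpa using hp)

theorem of_binary (h : R s [p, q]) (hp : Derives R p) (hq : Derives R q) : Derives R s :=
  step h (by simpa using ⟨hp, hq⟩)

variable {cut neut : Bool} {lem : Formula → Prop}

theorem swap {A B : Formula} {Γ : List Formula} {Λ : Option Formula}
    (h : Derives (Rule cut neut lem) (A :: B :: Γ, Λ)) :
    Derives (Rule cut neut lem) (B :: A :: Γ, Λ) :=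
  of_unary (.exch [] Γ A B Λ) h

theorem head_of_pair (A B : Formula) : Derives (Rule cut neut lem) ([A, B], some A) :=
  swap (of_unary (.thinL B [A] _) (of_nullary (.ax A)))

end Derives

/-- for any formula F and propositional formula N, the formulas
N ⊃ F and ¬N ∨ F are equivalent in LJ+: both sequents N ⊃ F ⊢ ¬N ∨ F and
¬N ∨ F ⊢ N ⊃ F are derivable in LJ+. -/
theorem ljplus_imp_iff_or (F N : Formula) (hN : N.Propositional) :
    LJPlus ([N.imp F], some (N.neg.or F)) ∧
    LJPlus ([N.neg.or F], some (N.imp F)) := by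
  constructor
  · refine .of_binary (.neut' N _ _ rfl hN) ?_ ?_
    · exact .swap (.of_binary (.impL N F [N] [] _) (.of_nullary (.ax N))
        (.of_unary (.orR2 _ _ _) (.of_nullary (.ax F))))
    · exact .of_unary (.orR1 _ _ _) (.head_of_pair _ _)
  · refine .of_unary (.impR _ _ _) (.swap (.of_binary (.orL _ _ _ _) ?_ ?_))
    · exact .of_unary (.thinR _ _) (.of_unary (.negL _ _) (.of_nullary (.ax N)))
    · exact .head_of_pair _ _
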